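/- arXiv:math/0210177 — 2 statements merged into one kernel-verified Lean document; each statement's English description precedes it below -/
import Mathlib

section
/- Let a be an arbitrary element of S = R_P. Then for almost all α ∈ K^m, the element a_α is defined and lies in S_α; that is, writing a = f/g with f, g ∈ R and g ∉ P, one has g_α ∉ ℘ for almost all α, so a_α = f_α/g_α ∈ S_α. -/
set_option maxHeartbeats 1000000
set_option synthInstance.maxHeartbeats 1000000

noncomputable section

namespace Spl

open MvPolynomial

/-- "Q(α) holds for almost all α ∈ K^m", i.e. away from a proper algebraic
subvariety of `K^m`. -/
def AlmostAll (K : Type) [Field K] (m : ℕ) (Q : (Fin m → K) → Prop) : Prop :=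
  ∃ c : MvPolynomial (Fin m) K, c ≠ 0 ∧ ∀ α : Fin m → K, MvPolynomial.eval α c ≠ 0 → Q α

variable (k K : Type) [Field k] [Field K] [Algebra k K]

/-- the field k(u) of rational functions in u = (u_1, ..., u_m) -/
abbrev kU (m : ℕ) := FractionRing (MvPolynomial (Fin m) k)

/-- the polynomial ring R = k(u)[X_1, ..., X_n] -/
abbrev Rg (m n : ℕ) := MvPolynomial (Fin n) (kU k m)

/-- the subfield k(α) ⊆ K generated by α = (α_1, ..., α_m) over k -/
abbrev kA {m : ℕ} (α : Fin m → K) := IntermediateField.adjoin k (Set.range α)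

/-- the polynomial ring R_α = k(α)[X_1, ..., X_n] -/
abbrev Ra {m : ℕ} (n : ℕ) (α : Fin m → K) := MvPolynomial (Fin n) (kA k K α)

/-- evaluation u ↦ α, from k[u] to k(α) -/
def evalα {m : ℕ} (α : Fin m → K) : MvPolynomial (Fin m) k →+* kA k K α :=
  (MvPolynomial.aeval fun i =>
    (⟨α i, IntermediateField.subset_adjoin k (Set.range α) ⟨i, rfl⟩⟩ : kA k K α)).toRingHom

/-- the inclusion k[u][X] → R = k(u)[X] -/
def toR (m n : ℕ) : MvPolynomial (Fin n) (MvPolynomial (Fin m) k) →+* Rg k m n :=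
  MvPolynomial.map (algebraMap (MvPolynomial (Fin m) k) (kU k m))

/-- substitution u ↦ α, from k[u][X] to R_α = k(α)[X] -/
def toRa {m : ℕ} (n : ℕ) (α : Fin m → K) :
    MvPolynomial (Fin n) (MvPolynomial (Fin m) k) →+* Ra k K n α :=
  MvPolynomial.map (evalα k K α)

/-- Krull's specialization I_α = { f(α,X) | f(u,X) ∈ I ∩ k[u,X] } of an ideal I ⊆ R
(as an ideal of R_α, i.e. the ideal spanned by the specialized elements). -/
def idealSpec {m : ℕ} (n : ℕ) (α : Fin m → K) (I : Ideal (Rg k m n)) :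
    Ideal (Ra k K n α) :=
  Ideal.span (toRa k K n α '' { f | toR k m n f ∈ I })

/-- `ElemSpec k K n α f fα` : fα is the specialization of f ∈ R at α, i.e. writing
f = p(u,X)/q(u) with q(α) ≠ 0 one has fα = p(α,X)/q(α). -/
def ElemSpec {m : ℕ} (n : ℕ) (α : Fin m → K) (f : Rg k m n) (fα : Ra k K n α) : Prop :=
  ∃ (p : MvPolynomial (Fin n) (MvPolynomial (Fin m) k)) (q : MvPolynomial (Fin m) k),
    evalα k K α q ≠ 0 ∧
    MvPolynomial.C (algebraMap (MvPolynomial (Fin m) k) (kU k m) q) * f = toR k m n p ∧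
    MvPolynomial.C (evalα k K α q) * fα = toRa k K n α p

variable {k K}

/-- `LocElemSpec P ℘ a aα` : aα ∈ S_α = (R_α)_℘ is the specialization of a ∈ S = R_P,
i.e. writing a = f/g with f, g ∈ R, g ∉ P, one has g_α ∉ ℘ and aα = f_α/g_α. -/
def LocElemSpec {m n : ℕ} {α : Fin m → K} (P : Ideal (Rg k m n)) [P.IsPrime]
    (℘ : Ideal (Ra k K n α)) [℘.IsPrime]
    {S : Type} [CommRing S] [Algebra (Rg k m n) S] [IsLocalization.AtPrime S P]
    {Sα : Type} [CommRing Sα] [Algebra (Ra k K n α) Sα] [IsLocalization.AtPrime Sα ℘]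
    (a : S) (aα : Sα) : Prop :=
  ∃ (f g : Rg k m n) (fα gα : Ra k K n α) (hg : g ∈ P.primeCompl)
    (hgα : gα ∈ ℘.primeCompl),
    ElemSpec k K n α f fα ∧ ElemSpec k K n α g gα ∧
    a = IsLocalization.mk' S f ⟨g, hg⟩ ∧
    aα = IsLocalization.mk' Sα fα ⟨gα, hgα⟩

/-- entrywise specialization of matrices, relative to an element-specialization
relation `E`. -/
def MatSpec {S T : Type} (E : S → T → Prop) {r s : ℕ}
    (A : Matrix (Fin r) (Fin s) S) (B : Matrix (Fin r) (Fin s) T) : Prop :=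
  ∀ i j, E (A i j) (B i j)

/-- the cokernel of the linear map attached to a matrix A, i.e. the module
presented by A. -/
abbrev MatCoker {S : Type} [CommRing S] {r s : ℕ} (A : Matrix (Fin r) (Fin s) S) :=
  (Fin r → S) ⧸ LinearMap.range A.mulVecLin

/-- a finite free presentation F_1 → F_0 → L → 0 of the module L, where the map
F_1 → F_0 is given by the matrix A and the map F_0 → L is π. -/
structure Present (S : Type) [CommRing S] (r s : ℕ) (L : Type) [AddCommGroup L]
    [Module S L] where
  A : Matrix (Fin r) (Fin s) S
  π : (Fin r → S) →ₗ[S] L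
  surj : Function.Surjective π
  ker_eq : LinearMap.ker π = LinearMap.range A.mulVecLin

theorem comm_le {S : Type} [CommRing S] {r s r' s' : ℕ} {B : Matrix (Fin r) (Fin s) S}
    {C : Matrix (Fin r') (Fin s') S} {W : Matrix (Fin r') (Fin r) S}
    {W1 : Matrix (Fin s') (Fin s) S} (h : W * B = C * W1) :
    LinearMap.range B.mulVecLin ≤ (LinearMap.range C.mulVecLin).comap W.mulVecLin := by
  rintro x ⟨y, rfl⟩
  exact ⟨W1.mulVecLin y, by
    simp only [Matrix.mulVecLin_apply, Matrix.mulVec_mulVec, h]⟩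

/-- the map between the modules presented by B and C induced by the matrix W
(a specialization of a lift of a map between the presented modules). -/
def cokerMap {S : Type} [CommRing S] {r s r' s' : ℕ} {B : Matrix (Fin r) (Fin s) S}
    {C : Matrix (Fin r') (Fin s') S} (W : Matrix (Fin r') (Fin r) S)
    (h : LinearMap.range B.mulVecLin ≤ (LinearMap.range C.mulVecLin).comap W.mulVecLin) :
    MatCoker B →ₗ[S] MatCoker C :=
  Submodule.mapQ _ _ W.mulVecLin h

/-- a lift of a homomorphism v : L → M to given finite free presentations of L and M:
a commutative diagram whose vertical maps are given by the matrices V1, V0. -/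
structure MapLift {S : Type} [CommRing S] {rL sL rM sM : ℕ} {L M : Type}
    [AddCommGroup L] [Module S L] [AddCommGroup M] [Module S M]
    (pL : Present S rL sL L) (pM : Present S rM sM M) (v : L →ₗ[S] M) where
  V0 : Matrix (Fin rM) (Fin rL) S
  V1 : Matrix (Fin sM) (Fin sL) S
  comm0 : pM.π ∘ₗ V0.mulVecLin = v ∘ₗ pL.π
  comm1 : V0 * pL.A = pM.A * V1

/-- Krull dimension of a module, dim L = dim S/Ann L. -/
def moduleDim (S : Type) [CommRing S] (L : Type) [AddCommGroup L] [Module S L] :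
    WithBot ℕ∞ :=
  ringKrullDim (S ⧸ Module.annihilator S L)

/-- height of an ideal: the infimum of dim S_p over the primes p ⊇ I. -/
def idealHeight {S : Type} [CommRing S] (I : Ideal S) : WithBot ℕ∞ :=
  sInf { d | ∃ (p : Ideal S) (hp : p.IsPrime), I ≤ p ∧
    d = ringKrullDim (Localization (@Ideal.primeCompl _ _ p hp)) }

/-- length of a module: the longest chain of submodules. -/
def moduleLength (S : Type) [CommRing S] (L : Type) [AddCommGroup L] [Module S L] :
    WithBot ℕ∞ :=
  Order.krullDim (Submodule S L)

/-- grade(𝔞, L) ≥ t : there is an L-regular sequence of length t in 𝔞. -/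
def GradeGE {S : Type} [CommRing S] (𝔞 : Ideal S) (L : Type) [AddCommGroup L]
    [Module S L] (t : ℕ) : Prop :=
  ∃ rs : List S, rs.length = t ∧ (∀ x ∈ rs, x ∈ 𝔞) ∧ RingTheory.Sequence.IsRegular L rs

/-- grade(𝔞, L) : the length of a maximal L-regular sequence in 𝔞. -/
def grade {S : Type} [CommRing S] (𝔞 : Ideal S) (L : Type) [AddCommGroup L]
    [Module S L] : ℕ∞ :=
  sSup { t : ℕ∞ | ∃ t' : ℕ, t = (t' : ℕ∞) ∧ GradeGE 𝔞 L t' }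

/-- depth of a module over a local ring: grade(𝔪, L). -/
def depth (S : Type) [CommRing S] [IsLocalRing S] (L : Type) [AddCommGroup L]
    [Module S L] : ℕ∞ :=
  grade (IsLocalRing.maximalIdeal S) L

/-- proj dim L ≤ d : L admits a finite free resolution of length ≤ d, encoded as a
(possibly infinite) free resolution ⋯ → F_1 → F_0 → L → 0 with F_j = 0 for j > d. -/
def ProjDimLE (S : Type) [CommRing S] (L : Type) [AddCommGroup L] [Module S L]
    (d : ℕ) : Prop :=
  ∃ (r : ℕ → ℕ) (A : ∀ j : ℕ, Matrix (Fin (r j)) (Fin (r (j + 1))) S)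
    (π : (Fin (r 0) → S) →ₗ[S] L),
    Function.Surjective π ∧ LinearMap.ker π = LinearMap.range (A 0).mulVecLin ∧
    (∀ j : ℕ, LinearMap.ker (A j).mulVecLin = LinearMap.range (A (j + 1)).mulVecLin) ∧
    ∀ j : ℕ, d < j → r j = 0

/-- projective dimension of a module, as an extended natural number. -/
def projDim (S : Type) [CommRing S] (L : Type) [AddCommGroup L] [Module S L] : ℕ∞ :=
  sInf { d : ℕ∞ | ∃ d' : ℕ, d = (d' : ℕ∞) ∧ ProjDimLE S L d' }

/-- the i-th local cohomology module H^i_𝔞(L) as a module. -/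
abbrev localCoh {S : Type} [CommRing S] (𝔞 : Ideal S) (i : ℕ) (L : Type)
    [AddCommGroup L] [Module S L] : ModuleCat S :=
  (localCohomology 𝔞 i).obj (ModuleCat.of S L)

/-- the colon submodule (0 :_L 𝔞) = { x ∈ L | 𝔞 x = 0 }. -/
def colonSubmodule {S : Type} [CommRing S] (𝔞 : Ideal S) (L : Type) [AddCommGroup L]
    [Module S L] : Submodule S L where
  carrier := { x | ∀ c ∈ 𝔞, c • x = 0 }
  add_mem' := by
    intro a b ha hb c hc
    rw [smul_add, ha c hc, hb c hc, add_zero]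
  zero_mem' := by
    intro c _
    rw [smul_zero]
  smul_mem' := by
    intro s x hx c hc
    rw [smul_comm, hx c hc, smul_zero]

/-- a (partial) system of parameters: the d = dim L elements a_1, ..., a_d lie in the
maximal ideal and L/(a_1, ..., a_d)L has dimension ≤ 0. -/
def IsSOP (S : Type) [CommRing S] [IsLocalRing S] (L : Type) [AddCommGroup L]
    [Module S L] {d : ℕ} (a : Fin d → S) : Prop :=
  (∀ i, a i ∈ IsLocalRing.maximalIdeal S) ∧
  moduleDim S L = (d : ℕ∞) ∧
  moduleDim S (L ⧸ (Ideal.span (Set.range a) • (⊤ : Submodule S L))) ≤ 0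

/-- a standard system of parameters: (a_1, ..., a_d) H^i_𝔪(L/(a_1, ..., a_j)L) = 0
for all i + j < d. -/
def IsStandardSOP (S : Type) [CommRing S] [IsLocalRing S] (L : Type) [AddCommGroup L]
    [Module S L] {d : ℕ} (a : Fin d → S) : Prop :=
  IsSOP S L a ∧
  ∀ i j : ℕ, i + j < d →
    Ideal.span (Set.range a) ≤ Module.annihilator S
      (localCoh (IsLocalRing.maximalIdeal S) i
        (L ⧸ (Ideal.span (a '' { x : Fin d | (x : ℕ) < j }) • (⊤ : Submodule S L))))

/-- a standard ideal for L: an 𝔪-primary ideal 𝔞 such that every system of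
parameters of L contained in 𝔞 is standard. -/
def IsStandardIdeal (S : Type) [CommRing S] [IsLocalRing S] (L : Type) [AddCommGroup L]
    [Module S L] (𝔞 : Ideal S) : Prop :=
  𝔞.radical = IsLocalRing.maximalIdeal S ∧
  ∀ (d : ℕ) (a : Fin d → S), (∀ i, a i ∈ 𝔞) → IsSOP S L a → IsStandardSOP S L a


section Specialization

variable {σ A : Type*} [CommRing A]

/-- Over a domain, one nonzero constant `c` serves as the leading coefficient, in every degree that
occurs in a given ideal of a polynomial ring, of some element of that ideal. -/
theorem exists_ne_zero_forall_leadingCoeff_eq [IsDomain A] [Finite σ] (mo : MonomialOrder σ)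
    (G : Ideal (MvPolynomial σ A)) :
    ∃ c : A, c ≠ 0 ∧ ∀ x ∈ G, x ≠ 0 →
      ∃ e ∈ G, mo.degree e = mo.degree x ∧ mo.leadingCoeff e = c := by
  classical
  let D : Set (σ →₀ ℕ) := {d | ∃ x ∈ G, x ≠ 0 ∧ mo.degree x = d}
  have hpwo : D.IsPWO := Set.isPWO_of_wellQuasiOrderedLE D
  have hfin : {d | Minimal (· ∈ D) d}.Finite :=
    (setOfPred_minimal_antichain _).finite_of_partiallyWellOrderedOn
      (hpwo.mono fun _ hd => hd.prop)
  have hmem : ∀ d : hfin.toFinset, ∃ x ∈ G, x ≠ 0 ∧ mo.degree x = d := fun d =>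
    ((hfin.mem_toFinset).1 d.2).prop
  choose b hbG hb0 hbd using hmem
  refine ⟨∏ d, mo.leadingCoeff (b d),
    Finset.prod_ne_zero_iff.2 fun d _ => mo.leadingCoeff_ne_zero_iff.2 (hb0 d), ?_⟩
  intro x hx hx0
  obtain ⟨d, hdx, hd⟩ := hpwo.exists_le_minimal (show mo.degree x ∈ D from ⟨x, hx, hx0, rfl⟩)
  set i : hfin.toFinset := ⟨d, hfin.mem_toFinset.2 hd⟩
  set r : A := ∏ j ∈ Finset.univ.erase i, mo.leadingCoeff (b j)
  have hr : r ≠ 0 :=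
    Finset.prod_ne_zero_iff.2 fun j _ => mo.leadingCoeff_ne_zero_iff.2 (hb0 j)
  have hne : mo.leadingCoeff (monomial (mo.degree x - d) r) * mo.leadingCoeff (b i) ≠ 0 := by
    rw [mo.leadingCoeff_monomial]
    exact mul_ne_zero hr (mo.leadingCoeff_ne_zero_iff.2 (hb0 i))
  refine ⟨monomial (mo.degree x - d) r * b i, G.mul_mem_left _ (hbG i), ?_, ?_⟩
  · rw [mo.degree_mul_of_mul_leadingCoeff_ne_zero hne, mo.degree_monomial, if_neg hr, hbd]
    exact tsub_add_cancel_of_le hdx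
  · rw [mo.leadingCoeff_mul_of_mul_leadingCoeff_ne_zero hne, mo.leadingCoeff_monomial]
    exact Finset.prod_erase_mul _ _ (Finset.mem_univ i)

/-- If `c` is a leading coefficient in every degree that occurs in the ideal `G`, then `G ∩ 𝔮A[X]`
and `𝔮G` agree up to powers of `c`. -/
theorem exists_C_pow_mul_mem_map_C_mul (mo : MonomialOrder σ) {G : Ideal (MvPolynomial σ A)} {c : A}
    (hc : ∀ x ∈ G, x ≠ 0 → ∃ e ∈ G, mo.degree e = mo.degree x ∧ mo.leadingCoeff e = c)
    (𝔮 : Ideal A) {x : MvPolynomial σ A} (hxG : x ∈ G) (hxq : x ∈ 𝔮.map (C (σ := σ))) :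
    ∃ N : ℕ, C c ^ N * x ∈ 𝔮.map C * G := by
  induction hs : mo.toSyn (mo.degree x) using WellFoundedLT.induction generalizing x with
  | ind s ih =>
  subst hs
  by_cases hx0 : x = 0
  · exact ⟨0, by simp [hx0]⟩
  obtain ⟨e, heG, hed, hec⟩ := hc x hxG hx0
  have hlq : C (mo.leadingCoeff x) ∈ 𝔮.map (C (σ := σ)) :=
    Ideal.mem_map_of_mem _ (mem_map_C_iff.1 hxq _)
  set y := C c * x - C (mo.leadingCoeff x) * e with hy
  have hyG : y ∈ G := G.sub_mem (G.mul_mem_left _ hxG) (G.mul_mem_left _ heG)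
  have hyq : y ∈ 𝔮.map (C (σ := σ)) :=
    Ideal.sub_mem _ (Ideal.mul_mem_left _ _ hxq) (Ideal.mul_mem_right _ _ hlq)
  have key : ∃ N : ℕ, C c ^ N * y ∈ 𝔮.map C * G := by
    by_cases hy0 : y = 0
    · exact ⟨0, by simp [hy0]⟩
    refine ih _ (lt_of_le_of_ne ?_ ?_) hyG hyq rfl
    · rw [hy, sub_eq_add_neg, ← neg_mul, ← C_neg, ← smul_eq_C_mul, ← smul_eq_C_mul]
      refine mo.degree_add_le.trans (sup_le mo.degree_smul_le ?_)
      exact hed ▸ mo.degree_smul_le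
    · intro h
      apply mo.leadingCoeff_ne_zero_iff.2 hy0
      rw [MonomialOrder.leadingCoeff, mo.toSyn.injective h, hy, coeff_sub, coeff_C_mul,
        coeff_C_mul, ← hec]
      simp only [MonomialOrder.leadingCoeff, hed]
      ring
  obtain ⟨N, hN⟩ := key
  refine ⟨N + 1, ?_⟩
  have : C c ^ (N + 1) * x = C c ^ N * y + C c ^ N * (C (mo.leadingCoeff x) * e) := by
    rw [hy]; ring
  rw [this]
  exact Ideal.add_mem _ hN (Ideal.mul_mem_left _ _ (Ideal.mul_mem_mul hlq heG))

/-- Clearing denominators in a polynomial over a field all of whose elements are fractions of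
elements of the image of `φ`. -/
theorem exists_C_mul_eq_map {L : Type*} [Field L] {φ : A →+* L}
    (hφ : ∀ l : L, ∃ d a : A, φ d ≠ 0 ∧ φ d * l = φ a) (h : MvPolynomial σ L) :
    ∃ (d : A) (h' : MvPolynomial σ A), φ d ≠ 0 ∧ C (φ d) * h = map φ h' := by
  induction h using MvPolynomial.induction_on with
  | C l =>
    obtain ⟨d, a, hd, hda⟩ := hφ l
    exact ⟨d, C a, hd, by rw [← C_mul, hda, map_C]⟩
  | add p q hp hq =>
    obtain ⟨d, p', hd, hp⟩ := hp
    obtain ⟨e, q', he, hq⟩ := hq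
    refine ⟨d * e, C e * p' + C d * q', by simp [hd, he], ?_⟩
    simp only [map_mul, map_add, map_C, ← hp, ← hq]
    ring
  | mul_X p i hp =>
    obtain ⟨d, p', hd, hp⟩ := hp
    exact ⟨d, p' * X i, hd, by rw [map_mul, map_X, ← hp, mul_assoc]⟩

/-- Clearing denominators in an element of the extension of an ideal `I`, the result being the image
of an element of `I`. -/
theorem exists_C_mul_eq_map_of_mem_map {L : Type*} [Field L] {φ : A →+* L}
    (hφ : ∀ l : L, ∃ d a : A, φ d ≠ 0 ∧ φ d * l = φ a) {I : Ideal (MvPolynomial σ A)}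
    {x : MvPolynomial σ L} (hx : x ∈ I.map (map φ)) :
    ∃ d : A, ∃ i ∈ I, φ d ≠ 0 ∧ C (φ d) * x = map φ i := by
  induction hx using Submodule.span_induction with
  | mem x hx =>
    obtain ⟨i, hi, rfl⟩ := hx
    exact ⟨1, i, hi, by simp, by simp⟩
  | zero => exact ⟨1, 0, I.zero_mem, by simp, by simp⟩
  | add x y _ _ hx hy =>
    obtain ⟨d, i, hi, hd, hx⟩ := hx
    obtain ⟨e, j, hj, he, hy⟩ := hy
    refine ⟨d * e, C e * i + C d * j, I.add_mem (I.mul_mem_left _ hi) (I.mul_mem_left _ hj),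
      by simp [hd, he], ?_⟩
    simp only [map_mul, map_add, map_C, ← hx, ← hy]
    ring
  | smul r x _ hx =>
    obtain ⟨d, i, hi, hd, hx⟩ := hx
    obtain ⟨e, r', he, hr⟩ := exists_C_mul_eq_map hφ r
    refine ⟨d * e, r' * i, I.mul_mem_left _ hi, by simp [hd, he], ?_⟩
    simp only [map_mul, smul_eq_mul, ← hx, ← hr]
    ring

/-- An element outside a prime ideal `I` of `A[X]` stays a nonzerodivisor modulo `I` under almost
all specializations of `A` to a field. -/
theorem exists_ne_zero_forall_mem_map_of_mul_mem_map.{w} [IsDomain A] [Finite σ]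
    (I : Ideal (MvPolynomial σ A)) [I.IsPrime] {g : MvPolynomial σ A} (hg : g ∉ I) :
    ∃ c : A, c ≠ 0 ∧ ∀ (L : Type w) [Field L] (φ : A →+* L),
      (∀ l : L, ∃ d a : A, φ d ≠ 0 ∧ φ d * l = φ a) → φ c ≠ 0 →
      ∀ h : MvPolynomial σ L, map φ g * h ∈ I.map (map φ) → h ∈ I.map (map φ) := by
  let ⟨_, _⟩ := exists_wellFoundedLT σ
  let mo : MonomialOrder σ := MonomialOrder.lex
  set G := I ⊔ Ideal.span {g} with hG
  obtain ⟨c, hc0, hc⟩ := exists_ne_zero_forall_leadingCoeff_eq mo G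
  refine ⟨c, hc0, fun L _ φ hφ hφc h hgh => ?_⟩
  have hker : RingHom.ker (map φ : MvPolynomial σ A →+* _) = (RingHom.ker φ).map C := ker_map φ
  have of_C_mul {a : L} (ha : a ≠ 0) {x : MvPolynomial σ L}
      (hx : C a * x ∈ I.map (map φ)) : x ∈ I.map (map φ) := by
    have := Ideal.mul_mem_left _ (C a⁻¹) hx
    rwa [← mul_assoc, ← C_mul, inv_mul_cancel₀ ha, C_1, one_mul] at this
  obtain ⟨d, h', hd, hh'⟩ := exists_C_mul_eq_map hφ h
  have hgh' : map φ g * map φ h' ∈ I.map (map φ) := by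
    rw [← hh', mul_left_comm]
    exact Ideal.mul_mem_left _ _ hgh
  obtain ⟨e, i, hi, he, hei⟩ := exists_C_mul_eq_map_of_mem_map hφ hgh'
  have hxq : C e * (g * h') - i ∈ (RingHom.ker φ).map C := by
    rw [← hker, RingHom.mem_ker]
    simp [← hei]
  have hxG : C e * (g * h') - i ∈ G :=
    G.sub_mem (G.mul_mem_left _ (G.mul_mem_right _ (Ideal.mem_sup_right
      (Ideal.mem_span_singleton_self g)))) (Ideal.mem_sup_left hi)
  obtain ⟨N, hN⟩ := exists_C_pow_mul_mem_map_C_mul mo hc _ hxG hxq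
  rw [hG, Ideal.mul_sup, Submodule.mem_sup] at hN
  obtain ⟨j, hj, z, hz, hjz⟩ := hN
  obtain ⟨b, hb, rfl⟩ := Ideal.mem_mul_span_singleton.1 hz
  have hmem : C c ^ N * C e * h' - b ∈ I := by
    refine (‹I.IsPrime›.mem_or_mem (x := g) ?_).resolve_left hg
    have : g * (C c ^ N * C e * h' - b) = j + C c ^ N * i := by linear_combination -hjz
    rw [this]
    exact I.add_mem (Ideal.mul_le_right hj) (I.mul_mem_left _ hi)
  have hb0 : map φ b = 0 := by rwa [← RingHom.mem_ker, hker]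
  have := Ideal.mem_map_of_mem (map φ) hmem
  simp only [map_sub, map_mul, map_pow, map_C, hb0, sub_zero, ← hh'] at this
  refine of_C_mul (a := φ c ^ N * φ e * φ d) (by simp [hφc, he, hd]) ?_
  rwa [C_mul, C_mul, C_pow, mul_assoc]

end Specialization

theorem coe_evalα {m : ℕ} (α : Fin m → K) (p : MvPolynomial (Fin m) k) :
    (evalα k K α p : K) = aeval α p :=
  comp_aeval_apply (R := k) (f := fun i =>
    (⟨α i, IntermediateField.subset_adjoin k (Set.range α) ⟨i, rfl⟩⟩ : kA k K α))
    (IntermediateField.val (kA k K α)) p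

theorem exists_evalα_mul_eq {m : ℕ} (α : Fin m → K) (l : kA k K α) :
    ∃ d a : MvPolynomial (Fin m) k, evalα k K α d ≠ 0 ∧ evalα k K α d * l = evalα k K α a := by
  obtain ⟨r, s, hrs⟩ := (IntermediateField.mem_adjoin_range_iff k α (l : K)).1 l.2
  by_cases hs : aeval α s = 0
  · refine ⟨1, 0, by simp, ?_⟩
    rw [hs, div_zero] at hrs
    rw [Subtype.ext (a2 := (0 : kA k K α)) hrs]
    simp
  · refine ⟨s, r, fun h => hs ?_, Subtype.ext ?_⟩
    · rw [← coe_evalα, h]; rfl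
    · change (evalα k K α s : K) * l = evalα k K α r
      rw [coe_evalα, coe_evalα, hrs, mul_div_cancel₀ _ hs]

theorem exists_C_mul_eq_toR {m n : ℕ} (f : Rg k m n) :
    ∃ (q : MvPolynomial (Fin m) k) (p : MvPolynomial (Fin n) (MvPolynomial (Fin m) k)),
      algebraMap (MvPolynomial (Fin m) k) (kU k m) q ≠ 0 ∧
      C (algebraMap (MvPolynomial (Fin m) k) (kU k m) q) * f = toR k m n p := by
  refine exists_C_mul_eq_map (fun l => ?_) f
  obtain ⟨⟨a, d⟩, had⟩ := IsLocalization.surj (nonZeroDivisors (MvPolynomial (Fin m) k)) l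
  exact ⟨d, a, IsLocalization.to_map_ne_zero_of_mem_nonZeroDivisors _ le_rfl d.2,
    by rw [mul_comm]; exact had⟩

/-- A nonzerodivisor on a module lies in none of its associated primes. -/
theorem notMem_of_isAssociatedPrime {R M : Type*} [CommRing R] [AddCommGroup M] [Module R M]
    {r : R} (hr : ∀ x : M, r • x = 0 → x = 0) {p : Ideal R} (hp : IsAssociatedPrime p M) :
    r ∉ p := by
  intro hrp
  obtain ⟨x, hx⟩ := hp.eq_radical_colon
  obtain ⟨N, hN⟩ := hx ▸ hrp
  rw [Submodule.mem_colon_singleton, Submodule.mem_bot] at hN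
  have hx0 : x = 0 := by
    clear hx
    induction N with
    | zero => simpa using hN
    | succ N ih =>
      rw [pow_succ', mul_smul] at hN
      exact ih (hr _ hN)
  apply hp.isPrime.ne_top
  rw [hx, Ideal.radical_eq_top, Ideal.eq_top_iff_one]
  simp [Submodule.mem_colon_singleton, hx0]

/-- For `a ∈ S = R_P`, written as `a = f/g` with `f, g ∈ R`, `g ∉ P`,
for almost all `α` the specializations `f_α`, `g_α` are defined and `g_α ∉ ℘` for
every associated prime `℘` of `P_α` (so that `a_α = f_α/g_α` is defined); hence
`a_α` lies in `S_α = (R_α)_℘`. -/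
theorem specialization_of_element_lies_in_Salpha
    (k K : Type) [Field k] [Field K] [Algebra k K] [Infinite K] {m n : ℕ}
    (P : Ideal (Rg k m n)) [P.IsPrime]
    (S : Type) [CommRing S] [Algebra (Rg k m n) S] [IsLocalization.AtPrime S P]
    (a : S) (f g : Rg k m n) (hg : g ∈ P.primeCompl)
    (ha : a = IsLocalization.mk' S f ⟨g, hg⟩) :
    AlmostAll K m fun α =>
      (∃ fα gα : Ra k K n α, ElemSpec k K n α f fα ∧ ElemSpec k K n α g gα ∧
        ∀ ℘ : Ideal (Ra k K n α),
          IsAssociatedPrime ℘ ((Ra k K n α) ⧸ idealSpec k K n α P) → gα ∉ ℘) ∧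
      ∀ (℘ : Ideal (Ra k K n α))
        (h℘ : IsAssociatedPrime ℘ ((Ra k K n α) ⧸ idealSpec k K n α P)),
        haveI := h℘.isPrime
        ∀ (Sα : Type) [CommRing Sα] [Algebra (Ra k K n α) Sα]
          [IsLocalization.AtPrime Sα ℘], ∃ aα : Sα, LocElemSpec P ℘ a aα := by
  obtain ⟨qf, pf, hqf, hf⟩ := exists_C_mul_eq_toR f
  obtain ⟨qg, pg, hqg, hg'⟩ := exists_C_mul_eq_toR g
  have hpg : pg ∉ P.comap (toR k m n) := by
    rw [Ideal.mem_comap, ← hg']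
    intro h
    have := P.mul_mem_left (C (algebraMap (MvPolynomial (Fin m) k) (kU k m) qg)⁻¹) h
    rw [← mul_assoc, ← C_mul, inv_mul_cancel₀ hqg, C_1, one_mul] at this
    exact hg this
  obtain ⟨c, hc0, hc⟩ := exists_ne_zero_forall_mem_map_of_mul_mem_map (P.comap (toR k m n)) hpg
  have ne_zero_of_map {q : MvPolynomial (Fin m) k}
      (hq : algebraMap (MvPolynomial (Fin m) k) (kU k m) q ≠ 0) : q ≠ 0 := by
    rintro rfl; exact hq (map_zero _)
  refine ⟨map (algebraMap k K) (c * qf * qg), ?_, fun α hα => ?_⟩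
  · rw [Ne, map_eq_zero_iff _ (map_injective _ (algebraMap k K).injective)]
    exact mul_ne_zero (mul_ne_zero hc0 (ne_zero_of_map hqf)) (ne_zero_of_map hqg)
  have hα' : evalα k K α (c * qf * qg) ≠ 0 := by
    intro h
    rw [eval_map, ← aeval_def, ← coe_evalα, h] at hα
    exact hα rfl
  rw [map_mul, map_mul] at hα'
  have hcα := left_ne_zero_of_mul (left_ne_zero_of_mul hα')
  have hfα := right_ne_zero_of_mul (left_ne_zero_of_mul hα')
  have hgα := right_ne_zero_of_mul hα'
  have spec {q : MvPolynomial (Fin m) k} (hq : evalα k K α q ≠ 0) (x : Ra k K n α) :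
      C (evalα k K α q) * (C (evalα k K α q)⁻¹ * x) = x := by
    rw [← mul_assoc, ← C_mul, mul_inv_cancel₀ hq, C_1, one_mul]
  have hF : ElemSpec k K n α f (C (evalα k K α qf)⁻¹ * toRa k K n α pf) :=
    ⟨pf, qf, hfα, hf, spec hfα _⟩
  have hG : ElemSpec k K n α g (C (evalα k K α qg)⁻¹ * toRa k K n α pg) :=
    ⟨pg, qg, hgα, hg', spec hgα _⟩
  have hmem (℘ : Ideal (Ra k K n α))
      (h℘ : IsAssociatedPrime ℘ ((Ra k K n α) ⧸ idealSpec k K n α P)) :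
      C (evalα k K α qg)⁻¹ * toRa k K n α pg ∉ ℘ := by
    intro h
    have h' := ℘.mul_mem_left (C (evalα k K α qg)) h
    rw [spec hgα] at h'
    refine notMem_of_isAssociatedPrime (fun x hx => ?_) h℘ h'
    obtain ⟨x, rfl⟩ := Ideal.Quotient.mk_surjective x
    rw [Ideal.Quotient.eq_zero_iff_mem]
    refine hc _ (evalα k K α) (exists_evalα_mul_eq α) hcα x ?_
    exact Ideal.Quotient.eq_zero_iff_mem.1 hx
  refine ⟨⟨_, _, hF, hG, hmem⟩, fun ℘ h℘ Sα _ _ _ => ?_⟩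
  exact ⟨_, f, g, _, _, hg, hmem ℘ h℘, hF, hG, ha, rfl⟩

end Spl
end
end

section
/- Let D be a finitely generated R-module. Then for almost all α there is an isomorphism of S_α-modules (D ⊗_R S)_α ≅ D_α ⊗_{R_α} S_α, where D_α is the specialization of D as an R-module and (D ⊗_R S)_α is the specialization of the S-module D ⊗_R S. -/
set_option maxHeartbeats 1000000
set_option synthInstance.maxHeartbeats 1000000

noncomputable section

namespace Spl

open MvPolynomial

variable (k K : Type) [Field k] [Field K] [Algebra k K]

variable {k K}

theorem toR_injective (k : Type) [Field k] (m n : ℕ) : Function.Injective (toR k m n) :=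
  MvPolynomial.map_injective _ (IsFractionRing.injective _ _)

/-- Specialization of elements of `R` is multiplicative (and in particular well defined). -/
theorem ElemSpec.eq_mul {k K : Type} [Field k] [Field K] [Algebra k K] {m n : ℕ}
    {α : Fin m → K} {f g a : Rg k m n} {fα gα aα : Ra k K n α}
    (hf : ElemSpec k K n α f fα) (hg : ElemSpec k K n α g gα)
    (ha : ElemSpec k K n α a aα) (h : f = g * a) : fα = gα * aα := by
  obtain ⟨pf, qf, hqf, ef, eαf⟩ := hf
  obtain ⟨pg, qg, hqg, eg, eαg⟩ := hg
  obtain ⟨pa, qa, hqa, ea, eαa⟩ := ha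
  have hC (q : MvPolynomial (Fin m) k) :
      toR k m n (C q) = C (algebraMap (MvPolynomial (Fin m) k) (kU k m) q) :=
    MvPolynomial.map_C _ _
  have hCα (q : MvPolynomial (Fin m) k) : toRa k K n α (C q) = C (evalα k K α q) :=
    MvPolynomial.map_C _ _
  have key : C (qg * qa) * pf = C qf * (pg * pa) := by
    apply toR_injective k m n
    simp only [map_mul, hC, ← ef, ← eg, ← ea, h]
    ring
  have keyα := congrArg (toRa k K n α) key
  simp only [map_mul, hCα, ← eαf, ← eαg, ← eαa] at keyα
  have hne {q : MvPolynomial (Fin m) k} (hq : evalα k K α q ≠ 0) :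
      (C (evalα k K α q) : Ra k K n α) ≠ 0 := by
    rwa [Ne, MvPolynomial.C_eq_zero]
  refine mul_left_cancel₀ (mul_ne_zero (mul_ne_zero (hne hqf) (hne hqg)) (hne hqa)) ?_
  linear_combination keyα

/-- The specialization in `S_α` of an element coming from `R` is the image of its
specialization in `R_α`. -/
theorem LocElemSpec.eq_algebraMap {k K : Type} [Field k] [Field K] [Algebra k K] {m n : ℕ}
    {α : Fin m → K} {P : Ideal (Rg k m n)} [P.IsPrime] {℘ : Ideal (Ra k K n α)} [℘.IsPrime]
    {S : Type} [CommRing S] [Algebra (Rg k m n) S] [IsLocalization.AtPrime S P]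
    {Sα : Type} [CommRing Sα] [Algebra (Ra k K n α) Sα] [IsLocalization.AtPrime Sα ℘]
    {a : Rg k m n} {aα : Ra k K n α} {b : Sα} (ha : ElemSpec k K n α a aα)
    (hb : LocElemSpec P ℘ (algebraMap (Rg k m n) S a) b) :
    b = algebraMap (Ra k K n α) Sα aα := by
  obtain ⟨f, g, fα, gα, hg, hgα, hf, hgs, e, rfl⟩ := hb
  have hinj : Function.Injective (algebraMap (Rg k m n) S) :=
    IsLocalization.injective S P.primeCompl_le_nonZeroDivisors
  have hfg : f = g * a := by
    apply hinj
    rw [eq_comm, IsLocalization.mk'_eq_iff_eq_mul] at e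
    rw [e, map_mul, mul_comm]
  rw [IsLocalization.mk'_eq_iff_eq_mul, hf.eq_mul hgs ha hfg, map_mul, mul_comm]

/-- The module presented by a matrix commutes with base change. -/
theorem nonempty_matCoker_map_equiv {A T : Type} [CommRing A] [CommRing T] [Algebra A T]
    {r s : ℕ} (E : Matrix (Fin r) (Fin s) A) :
    Nonempty (MatCoker (E.map (algebraMap A T)) ≃ₗ[T] TensorProduct A T (MatCoker E)) := by
  let e (l : ℕ) := TensorProduct.piScalarRight A T T (Fin l)
  let q := (LinearMap.range E.mulVecLin).mkQ.baseChange T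
  let ψ : (Fin r → T) →ₗ[T] TensorProduct A T (MatCoker E) := q ∘ₗ (e r).symm.toLinearMap
  have hq : Function.Surjective q :=
    LinearMap.lTensor_surjective T (Submodule.mkQ_surjective _)
  have hψ : Function.Surjective ψ := hq.comp (e r).symm.surjective
  have hexact : LinearMap.ker q = LinearMap.range (E.mulVecLin.baseChange T) := by
    ext x
    exact lTensor_exact T (LinearMap.exact_map_mkQ_range E.mulVecLin)
      (Submodule.mkQ_surjective _) x
  have hcomm : (e r).toLinearMap ∘ₗ E.mulVecLin.baseChange T =
      (E.map (algebraMap A T)).mulVecLin ∘ₗ (e s).toLinearMap := by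
    apply TensorProduct.AlgebraTensorModule.curry_injective
    ext j i
    simp [e, Matrix.mulVec, dotProduct, Pi.single_apply, Algebra.smul_def]
  have hker : LinearMap.range (E.map (algebraMap A T)).mulVecLin = LinearMap.ker ψ := by
    rw [LinearMap.ker_comp, hexact, Submodule.comap_equiv_eq_map_symm, LinearEquiv.symm_symm,
      ← LinearMap.range_comp, hcomm,
      LinearMap.range_comp_of_range_eq_top _ (LinearEquiv.range _)]
  exact ⟨(Submodule.quotEquivOfEq _ _ hker).trans (ψ.quotKerEquivOfSurjective hψ)⟩

/-- compatibility of specializations of `S`-modules with those of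
`R`-modules: for a finitely generated `R`-module `D` (with finite free presentation
given by the matrix `pD.A` over `R`), for almost all `α` one has
`(D ⊗_R S)_α ≅ D_α ⊗_{R_α} S_α`.  Here `D ⊗_R S` is presented over `S` by the image
of `pD.A`, `D_α` is the `R_α`-module presented by a specialization `Eα` of `pD.A`,
and `(D ⊗_R S)_α` is the `S_α`-module presented by a specialization `B` of the
image of `pD.A` in `S`. -/
theorem specialization_tensor_localization_compat
    (k K : Type) [Field k] [Field K] [Algebra k K] [Infinite K] {m n : ℕ}
    (P : Ideal (Rg k m n)) [P.IsPrime]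
    (S : Type) [CommRing S] [Algebra (Rg k m n) S] [IsLocalization.AtPrime S P]
    (D : Type) [AddCommGroup D] [Module (Rg k m n) D] [Module.Finite (Rg k m n) D]
    {r s : ℕ} (pD : Present (Rg k m n) r s D) :
    AlmostAll K m fun α =>
      ∀ (℘ : Ideal (Ra k K n α))
        (h℘ : IsAssociatedPrime ℘ ((Ra k K n α) ⧸ idealSpec k K n α P)),
        haveI := h℘.isPrime
        ∀ (Sα : Type) [CommRing Sα] [Algebra (Ra k K n α) Sα]
          [IsLocalization.AtPrime Sα ℘]
          (Eα : Matrix (Fin r) (Fin s) (Ra k K n α))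
          (B : Matrix (Fin r) (Fin s) Sα),
          MatSpec (ElemSpec k K n α) pD.A Eα →
          MatSpec (LocElemSpec P ℘) (pD.A.map (algebraMap (Rg k m n) S)) B →
          Nonempty ((MatCoker B) ≃ₗ[Sα]
            TensorProduct (Ra k K n α) Sα (MatCoker Eα)) := by
  refine ⟨1, one_ne_zero, fun α _ ℘ h℘ => ?_⟩
  have := h℘.isPrime
  intro Sα _ _ _ Eα B hE hB
  obtain rfl : B = Eα.map (algebraMap (Ra k K n α) Sα) := by
    ext i j
    exact LocElemSpec.eq_algebraMap (hE i j) (hB i j)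
  exact nonempty_matCoker_map_equiv Eα

end Spl
end
end
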